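/- Let φ be an lsc submeasure, suppose I = Exh(φ) is a translation invariant ideal, and let a be a base sequence adapted to I. Let H = { r ∈ ℝ : j_a(|r|) ∈ I } and for r, s ∈ H let ρ(r,s) = φ(j_a(|r−s|)) + |r−s|. Then for every ε > 0 there exists δ > 0 such that for all r, s, t ∈ H, if ρ(r,s) < δ and ρ(s,t) < δ then ρ(r,t) < ε. -/

import Mathlib

open Set Filter
open scoped ENNReal

/-- `a₀ a₁ ⋯ a_{n-1}` as a real number: the product of the first `n` terms of the
base sequence (the paper's `a₁ ⋯ a_n`, re-indexed from 0). -/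
noncomputable def bProd (a : ℕ → ℕ) (n : ℕ) : ℝ := ∏ k ∈ Finset.range n, (a k : ℝ)

/-- The `n`-th digit (0-indexed; the paper's `(n+1)`-st digit) of the nonnegative
real `r` in base `a`:  `r_n = ⌊a₁⋯a_n (r - ⌊r⌋)⌋ - a_n ⌊a₁⋯a_{n-1} (r - ⌊r⌋)⌋`. -/
noncomputable def digit (a : ℕ → ℕ) (r : ℝ) (n : ℕ) : ℤ :=
  ⌊bProd a (n + 1) * Int.fract r⌋ - (a n : ℤ) * ⌊bProd a n * Int.fract r⌋

/-- `j_a(r) = { n : r_n ≠ r_{n+1} }`. -/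
def jSet (a : ℕ → ℕ) (r : ℝ) : Set ℕ := {n | digit a r n ≠ digit a r (n + 1)}

/-- An ideal of subsets of ℕ: closed under subsets and finite unions, containing
all singletons (hence nonempty). -/
def IsIdeal (I : Set (Set ℕ)) : Prop :=
  (∀ ⦃x y : Set ℕ⦄, x ∈ I → y ⊆ x → y ∈ I) ∧
  (∀ ⦃x y : Set ℕ⦄, x ∈ I → y ∈ I → x ∪ y ∈ I) ∧
  (∀ n : ℕ, ({n} : Set ℕ) ∈ I)

/-- Translation invariance of a family of subsets of ℕ. -/
def TransInv (I : Set (Set ℕ)) : Prop :=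
  ∀ x ∈ I, ({n | ∃ m ∈ x, n = m + 1} ∈ I) ∧ ({n | n + 1 ∈ x} ∈ I)

/-- A tall family: every infinite set of naturals has an infinite subset in the family. -/
def TallIdeal (I : Set (Set ℕ)) : Prop :=
  ∀ x : Set ℕ, x.Infinite → ∃ y, y ⊆ x ∧ y.Infinite ∧ y ∈ I

/-- The base sequence `a` is adapted to `I` if `{n : a_n ≠ a_{n+1}} ∈ I`. -/
def AdaptedTo (a : ℕ → ℕ) (I : Set (Set ℕ)) : Prop := {n | a n ≠ a (n + 1)} ∈ I

/-- A lower semicontinuous submeasure on subsets of ℕ. -/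
def IsLscSubmeasure (φ : Set ℕ → ℝ≥0∞) : Prop :=
  φ ∅ = 0 ∧
  (∀ ⦃x y : Set ℕ⦄, x ⊆ y → φ x ≤ φ y) ∧
  (∀ x y : Set ℕ, φ (x ∪ y) ≤ φ x + φ y) ∧
  (∀ n : ℕ, 0 < φ {n} ∧ φ {n} < ⊤) ∧
  (∀ x : Set ℕ, φ x = ⨆ n : ℕ, φ (x ∩ {k | k < n}))

/-- `Exh(φ) = { x ⊆ ℕ : φ(x \ {0,…,n-1}) → 0 }`. -/
def Exh (φ : Set ℕ → ℝ≥0∞) : Set (Set ℕ) :=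
  {x | Filter.Tendsto (fun n => φ (x \ {k | k < n})) Filter.atTop (nhds 0)}

/-- `pr(a)`: the set of primes dividing `a_n` for all but finitely many `n`. -/
def prSet (a : ℕ → ℕ) : Set ℕ := {p | p.Prime ∧ ∀ᶠ n in Filter.atTop, p ∣ a n}

/-- A base sequence is uniform if every prime dividing some `a_n` divides `a_n`
for all but finitely many `n`. -/
def UniformBase (a : ℕ → ℕ) : Prop :=
  ∀ p : ℕ, p.Prime → (∃ n, p ∣ a n) → ∀ᶠ n in Filter.atTop, p ∣ a n

/-- `ℚ_a`, viewed as a set of real numbers: fractions `k/l` with every prime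
divisor of `l` in `pr(a)`. -/
def Qa (a : ℕ → ℕ) : Set ℝ :=
  {r | ∃ (k : ℤ) (l : ℕ), 0 < l ∧ (∀ p : ℕ, p.Prime → p ∣ l → p ∈ prSet a) ∧
    r = (k : ℝ) / (l : ℝ)}

/-- `H = { r ∈ ℝ : j_a(|r|) ∈ I }`. -/
def Hset (a : ℕ → ℕ) (I : Set (Set ℕ)) : Set ℝ := {r | jSet a |r| ∈ I}

/-- `ρ(r,s) = φ(j_a(|r-s|)) + |r-s|`. -/
noncomputable def rho (a : ℕ → ℕ) (φ : Set ℕ → ℝ≥0∞) (r s : ℝ) : ℝ :=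
  (φ (jSet a |r - s|)).toReal + |r - s|

theorem bProd_succ (a : ℕ → ℕ) (n : ℕ) : bProd a (n + 1) = bProd a n * a n :=
  Finset.prod_range_succ _ _

theorem bProd_eq_natCast (a : ℕ → ℕ) (n : ℕ) :
    bProd a n = ((∏ k ∈ Finset.range n, a k : ℕ) : ℝ) := by
  simp [bProd]

theorem bProd_pos {a : ℕ → ℕ} (ha : ∀ n, 2 ≤ a n) (n : ℕ) : 0 < bProd a n :=
  Finset.prod_pos fun k _ => by
    have := ha k
    exact_mod_cast (by omega : 0 < a k)

theorem bProd_mono {a : ℕ → ℕ} (ha : ∀ n, 2 ≤ a n) : Monotone (bProd a) := by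
  refine monotone_nat_of_le_succ fun n => ?_
  rw [bProd_succ]
  have h : (1 : ℝ) ≤ a n := by
    have := ha n
    exact_mod_cast (by omega : 1 ≤ a n)
  exact le_mul_of_one_le_right (bProd_pos ha n).le h

/-- The digits can be computed without first passing to the fractional part. -/
theorem digit_eq (a : ℕ → ℕ) (r : ℝ) (n : ℕ) :
    digit a r n = ⌊bProd a (n + 1) * r⌋ - (a n : ℤ) * ⌊bProd a n * r⌋ := by
  have key : ∀ m : ℕ, ⌊bProd a m * r⌋ =
      ⌊bProd a m * Int.fract r⌋ + ((∏ k ∈ Finset.range m, a k : ℕ) : ℤ) * ⌊r⌋ := by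
    intro m
    rw [← Int.floor_add_intCast]
    congr 1
    conv_lhs => rw [← Int.fract_add_floor r]
    rw [bProd_eq_natCast]
    push_cast
    ring
  rw [digit, key n, key (n + 1), Finset.prod_range_succ]
  push_cast
  ring

theorem digit_nonneg (a : ℕ → ℕ) (r : ℝ) (n : ℕ) : 0 ≤ digit a r n := by
  rw [digit_eq, sub_nonneg, Int.le_floor, bProd_succ]
  push_cast
  nlinarith [Int.floor_le (bProd a n * r), Nat.cast_nonneg (α := ℝ) (a n)]

theorem digit_lt {a : ℕ → ℕ} (ha : ∀ n, 2 ≤ a n) (r : ℝ) (n : ℕ) : digit a r n < a n := by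
  have h : ⌊bProd a (n + 1) * r⌋ < (a n : ℤ) * (⌊bProd a n * r⌋ + 1) := by
    rw [Int.floor_lt, bProd_succ]
    push_cast
    have h0 : (0 : ℝ) < a n := by
      have := ha n
      exact_mod_cast (by omega : 0 < a n)
    nlinarith [Int.lt_floor_add_one (bProd a n * r)]
  rw [digit_eq]
  linarith

theorem digit_eq_zero {a : ℕ → ℕ} (ha : ∀ n, 2 ≤ a n) {x : ℝ} (hx : 0 ≤ x) {n : ℕ}
    (h : bProd a (n + 1) * x < 1) : digit a x n = 0 := by
  have h1 : ⌊bProd a (n + 1) * x⌋ = 0 :=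
    Int.floor_eq_zero_iff.2 ⟨mul_nonneg (bProd_pos ha _).le hx, h⟩
  have h2 : ⌊bProd a n * x⌋ = 0 :=
    Int.floor_eq_zero_iff.2 ⟨mul_nonneg (bProd_pos ha _).le hx,
      (mul_le_mul_of_nonneg_right (bProd_mono ha n.le_succ) hx).trans_lt h⟩
  rw [digit_eq, h1, h2]
  simp

/-- A small real has no digit changes at the beginning of its expansion. -/
theorem le_of_mem_jSet {a : ℕ → ℕ} (ha : ∀ n, 2 ≤ a n) {x : ℝ} (hx : 0 ≤ x) {N k : ℕ}
    (h : bProd a (N + 1) * x < 1) (hk : k ∈ jSet a x) : N ≤ k := by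
  by_contra! hlt
  have hz : ∀ m ≤ N, digit a x m = 0 := fun m hm =>
    digit_eq_zero ha hx
      ((mul_le_mul_of_nonneg_right (bProd_mono ha (by omega)) hx).trans_lt h)
  exact hk ((hz k (by omega)).trans (hz (k + 1) (by omega)).symm)

/-- If consecutive carries all come from the same digit sum `s` in the same base `A`,
the resulting digits agree. -/
theorem carry_digits_eq {A s c₀ c₁ c₂ c₃ σ : ℤ} (hσ : σ = 1 ∨ σ = -1)
    (h₀ : c₀ = 0 ∨ c₀ = 1) (h₁ : c₁ = 0 ∨ c₁ = 1) (h₂ : c₂ = 0 ∨ c₂ = 1)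
    (h₃ : c₃ = 0 ∨ c₃ = 1)
    (l₀ : 0 ≤ s + σ * (c₁ - A * c₀)) (u₀ : s + σ * (c₁ - A * c₀) < A)
    (l₁ : 0 ≤ s + σ * (c₂ - A * c₁)) (u₁ : s + σ * (c₂ - A * c₁) < A)
    (l₂ : 0 ≤ s + σ * (c₃ - A * c₂)) (u₂ : s + σ * (c₃ - A * c₂) < A) :
    s + σ * (c₁ - A * c₀) = s + σ * (c₂ - A * c₁) := by
  rcases hσ with rfl | rfl <;> rcases h₀ with rfl | rfl <;> rcases h₁ with rfl | rfl <;>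
    rcases h₂ with rfl | rfl <;> rcases h₃ with rfl | rfl <;> omega

theorem exists_carry_add (x y : ℝ) :
    ∃ c : ℤ, (c = 0 ∨ c = 1) ∧ ⌊x + y⌋ = ⌊x⌋ + ⌊y⌋ + c := by
  refine ⟨⌊x + y⌋ - ⌊x⌋ - ⌊y⌋, ?_, by ring⟩
  have h1 := Int.le_floor_add x y
  have h2 := Int.le_floor_add_floor x y
  omega

theorem exists_borrow_sub (x y : ℝ) :
    ∃ c : ℤ, (c = 0 ∨ c = 1) ∧ ⌊x - y⌋ = ⌊x⌋ - ⌊y⌋ - c := by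
  obtain ⟨c, hc, h⟩ := exists_carry_add (x - y) y
  rw [sub_add_cancel] at h
  exact ⟨c, hc, by linarith⟩

theorem jSet_subset_of_carry {a : ℕ → ℕ} (ha : ∀ n, 2 ≤ a n) {x y w : ℝ} {σ : ℤ}
    (hσ : σ = 1 ∨ σ = -1) {c : ℕ → ℤ} (hc : ∀ n, c n = 0 ∨ c n = 1)
    (h : ∀ n, ⌊bProd a n * w⌋ = ⌊bProd a n * x⌋ + σ * ⌊bProd a n * y⌋ + σ * c n) :
    jSet a w ⊆ (jSet a x ∪ jSet a y ∪ {n | a n ≠ a (n + 1)}) ∪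
      {n | n + 1 ∈ jSet a x ∪ jSet a y ∪ {n | a n ≠ a (n + 1)}} := by
  have hd : ∀ n, digit a w n =
      (digit a x n + σ * digit a y n) + σ * (c (n + 1) - a n * c n) := by
    intro n
    rw [digit_eq, digit_eq, digit_eq, h, h]
    ring
  intro n hn
  by_contra hcon
  simp only [jSet, mem_union, mem_ofPred_eq, not_or, not_not] at hcon
  obtain ⟨⟨⟨x₀, y₀⟩, a₀⟩, ⟨x₁, y₁⟩, a₁⟩ := hcon
  apply hn
  have b₀ := digit_nonneg a w n
  have b₁ := digit_nonneg a w (n + 1)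
  have b₂ := digit_nonneg a w (n + 1 + 1)
  have t₀ := digit_lt ha w n
  have t₁ := digit_lt ha w (n + 1)
  have t₂ := digit_lt ha w (n + 1 + 1)
  rw [hd] at b₀ b₁ b₂ t₀ t₁ t₂
  rw [hd n, hd (n + 1)]
  rw [← x₁, ← y₁, ← a₁, ← x₀, ← y₀, ← a₀] at b₂ t₂
  rw [← x₀, ← y₀, ← a₀] at b₁ t₁ ⊢
  exact carry_digits_eq hσ (hc _) (hc _) (hc _) (hc _) b₀ t₀ b₁ t₁ b₂ t₂

/-- Digit changes of `|x + y|` come from those of `|x|`, `|y|` and of the base, up to a shift. -/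
theorem jSet_abs_add_subset {a : ℕ → ℕ} (ha : ∀ n, 2 ≤ a n) (x y : ℝ) :
    jSet a |x + y| ⊆ (jSet a |x| ∪ jSet a |y| ∪ {n | a n ≠ a (n + 1)}) ∪
      {n | n + 1 ∈ jSet a |x| ∪ jSet a |y| ∪ {n | a n ≠ a (n + 1)}} := by
  have hsub : ∀ u v : ℝ, jSet a (u - v) ⊆
      (jSet a u ∪ jSet a v ∪ {n | a n ≠ a (n + 1)}) ∪
      {n | n + 1 ∈ jSet a u ∪ jSet a v ∪ {n | a n ≠ a (n + 1)}} := by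
    intro u v
    choose c hc h using fun n => exists_borrow_sub (bProd a n * u) (bProd a n * v)
    refine jSet_subset_of_carry ha (Or.inr rfl) hc fun n => ?_
    rw [mul_sub, h]
    ring
  have hcases : |x + y| = |x| + |y| ∨ |x + y| = |x| - |y| ∨ |x + y| = |y| - |x| := by
    rcases abs_cases x with ⟨hx, _⟩ | ⟨hx, _⟩ <;> rcases abs_cases y with ⟨hy, _⟩ | ⟨hy, _⟩ <;>
      rcases abs_cases (x + y) with ⟨hw, _⟩ | ⟨hw, _⟩ <;> rw [hx, hy, hw] <;>
      first
        | exact Or.inl (by linarith)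
        | exact Or.inr (Or.inl (by linarith))
        | exact Or.inr (Or.inr (by linarith))
  rcases hcases with h | h | h
  · rw [h]
    choose c hc h using fun n => exists_carry_add (bProd a n * |x|) (bProd a n * |y|)
    refine jSet_subset_of_carry ha (Or.inl rfl) hc fun n => ?_
    rw [mul_add, h]
    ring
  · rw [h]
    exact hsub _ _
  · rw [h, union_comm (jSet a |x|)]
    exact hsub _ _

theorem add_mem_Hset {a : ℕ → ℕ} (ha : ∀ n, 2 ≤ a n) {I : Set (Set ℕ)} (hid : IsIdeal I)
    (htr : TransInv I) (had : AdaptedTo a I) {x y : ℝ} (hx : x ∈ Hset a I)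
    (hy : y ∈ Hset a I) : x + y ∈ Hset a I := by
  have h := hid.2.1 (hid.2.1 hx hy) had
  exact hid.1 (hid.2.1 h (htr _ h).2) (jSet_abs_add_subset ha x y)

theorem neg_mem_Hset {a : ℕ → ℕ} {I : Set (Set ℕ)} {x : ℝ} (hx : x ∈ Hset a I) :
    -x ∈ Hset a I := by
  simpa only [Hset, mem_ofPred_eq, abs_neg] using hx

theorem sub_mem_Hset {a : ℕ → ℕ} (ha : ∀ n, 2 ≤ a n) {I : Set (Set ℕ)} (hid : IsIdeal I)
    (htr : TransInv I) (had : AdaptedTo a I) {x y : ℝ} (hx : x ∈ Hset a I)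
    (hy : y ∈ Hset a I) : x - y ∈ Hset a I := by
  rw [sub_eq_add_neg]
  exact add_mem_Hset ha hid htr had hx (neg_mem_Hset hy)

namespace IsLscSubmeasure

variable {φ : Set ℕ → ℝ≥0∞}

theorem le_add_of_subset (hφ : IsLscSubmeasure φ) {x y z : Set ℕ} (h : x ⊆ y ∪ z) :
    φ x ≤ φ y + φ z :=
  (hφ.2.1 h).trans (hφ.2.2.1 y z)

theorem biUnion_le (hφ : IsLscSubmeasure φ) (x : ℕ → Set ℕ) (s : Finset ℕ) :
    φ (⋃ i ∈ s, x i) ≤ ∑ i ∈ s, φ (x i) := by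
  induction s using Finset.induction_on with
  | empty => simp [hφ.1]
  | insert i s hi ih =>
    rw [Finset.sum_insert hi, Finset.set_biUnion_insert]
    exact (hφ.2.2.1 _ _).trans (by gcongr)

theorem iUnion_le (hφ : IsLscSubmeasure φ) (x : ℕ → Set ℕ) :
    φ (⋃ i, x i) ≤ ∑' i, φ (x i) := by
  rw [hφ.2.2.2.2]
  refine iSup_le fun n => ?_
  obtain ⟨s, hs, hsub⟩ := Set.finite_subset_iUnion
    ((Set.finite_lt_nat n).subset inter_subset_right) (inter_subset_left (s := ⋃ i, x i))
  refine (hφ.2.1 (y := ⋃ i ∈ hs.toFinset, x i) (by simpa using hsub)).trans ?_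
  exact (hφ.biUnion_le x _).trans (ENNReal.sum_le_tsum _)

theorem ne_top_of_mem_Exh (hφ : IsLscSubmeasure φ) {x : Set ℕ} (hx : x ∈ Exh φ) :
    φ x ≠ ⊤ := by
  obtain ⟨n, hn⟩ := (hx.eventually (gt_mem_nhds (zero_lt_one (α := ℝ≥0∞)))).exists
  have hfin : φ (⋃ i ∈ Finset.range n, {i}) < ⊤ :=
    (hφ.biUnion_le (fun i => {i}) _).trans_lt (ENNReal.sum_lt_top.2 fun i _ => (hφ.2.2.2.1 i).2)
  refine ((hφ.le_add_of_subset ?_).trans_lt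
    (ENNReal.add_lt_top.2 ⟨hfin, hn.trans ENNReal.one_lt_top⟩)).ne
  intro k hk
  by_cases hkn : k < n
  · left
    simpa using hkn
  · exact Or.inr ⟨hk, hkn⟩

theorem iUnion_mem_Exh (hφ : IsLscSubmeasure φ) (hid : IsIdeal (Exh φ)) {x : ℕ → Set ℕ}
    (hx : ∀ i, x i ∈ Exh φ) (hsum : ∑' i, φ (x i) ≠ ⊤) : (⋃ i, x i) ∈ Exh φ := by
  have hfin : ∀ K : ℕ, (⋃ i ∈ Finset.range K, x i) ∈ Exh φ := by
    intro K
    induction K with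
    | zero => simpa using hid.1 (hid.2.2 0) (empty_subset _)
    | succ K ih =>
      rw [Finset.range_add_one, Finset.set_biUnion_insert]
      exact hid.2.1 (hx K) ih
  refine ENNReal.tendsto_nhds_zero.2 fun η hη => ?_
  have hη2 : 0 < η / 2 := ENNReal.half_pos hη.ne'
  obtain ⟨K, hK⟩ := ((ENNReal.tendsto_sum_nat_add _ hsum).eventually (gt_mem_nhds hη2)).exists
  filter_upwards [(hfin K).eventually (gt_mem_nhds hη2)] with n hn
  rw [← ENNReal.add_halves η]
  refine (hφ.le_add_of_subset (z := ⋃ i, x (i + K)) ?_).trans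
    (add_le_add hn.le ((hφ.iUnion_le _).trans hK.le))
  rintro k ⟨hk, hkn⟩
  obtain ⟨i, hi⟩ := mem_iUnion.1 hk
  by_cases hiK : i < K
  · exact Or.inl ⟨mem_biUnion (Finset.mem_coe.2 (Finset.mem_range.2 hiK)) hi, hkn⟩
  · right
    refine mem_iUnion.2 ⟨i - K, ?_⟩
    rwa [Nat.sub_add_cancel (not_lt.1 hiK)]

/-- The left shift is continuous at `∅` on a translation invariant `Exh φ`. -/
theorem exists_shift_lt (hφ : IsLscSubmeasure φ) (hid : IsIdeal (Exh φ))
    (htr : TransInv (Exh φ)) {η : ℝ≥0∞} (hη : 0 < η) :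
    ∃ δ : ℝ≥0∞, 0 < δ ∧ ∀ x ∈ Exh φ, φ x < δ → φ {n | n + 1 ∈ x} < η := by
  by_contra! hcon
  obtain ⟨e, he, hesum⟩ := ENNReal.exists_pos_sum_of_countable' (one_ne_zero (α := ℝ≥0∞)) ℕ
  choose x hxI hxe hxη using fun i => hcon (e i) (he i)
  have hsum : ∑' i, φ (x i) ≠ ⊤ :=
    ((ENNReal.tsum_le_tsum fun i => (hxe i).le).trans_lt (hesum.trans ENNReal.one_lt_top)).ne
  have hshift := (htr _ (hφ.iUnion_mem_Exh hid hxI hsum)).2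
  obtain ⟨n, hn⟩ := (hshift.eventually (gt_mem_nhds hη)).exists
  have hzero : Tendsto (fun i => φ (x i)) atTop (nhds 0) :=
    ENNReal.tendsto_atTop_zero_of_tsum_ne_top hsum
  have hev : ∀ᶠ i in atTop, ∀ m ∈ {k | k < n + 1}, m ∉ x i := by
    refine (eventually_all_finite (Set.finite_lt_nat (n + 1))).2 fun m _ => ?_
    filter_upwards [hzero.eventually (gt_mem_nhds (hφ.2.2.2.1 m).1)] with i hi hm
    exact hi.not_ge (hφ.2.1 (singleton_subset_iff.2 hm))
  obtain ⟨i, hi⟩ := hev.exists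
  refine hn.not_ge ((hxη i).trans (hφ.2.1 fun k hk => ⟨mem_iUnion.2 ⟨i, hk⟩, fun hkn => ?_⟩))
  exact hi (k + 1) (Nat.succ_lt_succ hkn) hk

end IsLscSubmeasure

/-- Lemma 2.11: weak triangle inequality for `ρ` on `H`. -/
theorem rho_weak_triangle (a : ℕ → ℕ) (ha : ∀ n, 2 ≤ a n)
    (φ : Set ℕ → ℝ≥0∞) (hφ : IsLscSubmeasure φ)
    (hid : IsIdeal (Exh φ)) (htr : TransInv (Exh φ)) (had : AdaptedTo a (Exh φ)) :
    ∀ ε : ℝ, 0 < ε → ∃ δ : ℝ, 0 < δ ∧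
      ∀ r ∈ Hset a (Exh φ), ∀ s ∈ Hset a (Exh φ), ∀ t ∈ Hset a (Exh φ),
        rho a φ r s < δ → rho a φ s t < δ → rho a φ r t < ε := by
  intro ε hε
  set η : ℝ := ε / 8 with hηdef
  have hη : 0 < η := by positivity
  have hη' : 0 < ENNReal.ofReal η := ENNReal.ofReal_pos.2 hη
  obtain ⟨δ₁, hδ₁, hshift⟩ := hφ.exists_shift_lt hid htr hη'
  set D : Set ℕ := {n | a n ≠ a (n + 1)} with hD
  have hDI : D ∪ {n | n + 1 ∈ D} ∈ Exh φ := hid.2.1 had (htr _ had).2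
  obtain ⟨N, hN⟩ := (hDI.eventually (gt_mem_nhds hη')).exists
  obtain ⟨δ₂, hδ₂, hδ₂₁⟩ : ∃ d : ℝ, 0 < d ∧ ENNReal.ofReal d ≤ δ₁ := by
    refine ⟨(min δ₁ 1).toReal, ENNReal.toReal_pos (lt_min hδ₁ one_pos).ne' (by simp), ?_⟩
    rw [ENNReal.ofReal_toReal (by simp)]
    exact min_le_left _ _
  have hP := bProd_pos ha (N + 1)
  refine ⟨min (min δ₂ η) (1 / (2 * bProd a (N + 1))), by positivity, ?_⟩
  intro r hr s hs t ht hrs hst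
  rw [lt_min_iff, lt_min_iff] at hrs hst
  obtain ⟨⟨hrs₂, hrsη⟩, hrsP⟩ := hrs
  obtain ⟨⟨hst₂, hstη⟩, hstP⟩ := hst
  have small : ∀ u v d : ℝ, u - v ∈ Hset a (Exh φ) → rho a φ u v < d →
      φ (jSet a |u - v|) < ENNReal.ofReal d ∧ |u - v| < d := by
    intro u v d hu h
    have h1 : (φ (jSet a |u - v|)).toReal + |u - v| < d := h
    have h2 := ENNReal.toReal_nonneg (a := φ (jSet a |u - v|))
    have h3 := abs_nonneg (u - v)
    exact ⟨(ENNReal.lt_ofReal_iff_toReal_lt (hφ.ne_top_of_mem_Exh hu)).2 (by linarith),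
      by linarith⟩
  have hx : r - s ∈ Hset a (Exh φ) := sub_mem_Hset ha hid htr had hr hs
  have hy : s - t ∈ Hset a (Exh φ) := sub_mem_Hset ha hid htr had hs ht
  have hxy : r - t = (r - s) + (s - t) := by ring
  have habs : |r - t| ≤ |r - s| + |s - t| := abs_sub_le r s t
  have hstart : bProd a (N + 1) * |r - t| < 1 := by
    have h1 := (small r s _ hx hrsP).2
    have h2 := (small s t _ hy hstP).2
    calc bProd a (N + 1) * |r - t|
        < bProd a (N + 1) * (1 / (2 * bProd a (N + 1)) + 1 / (2 * bProd a (N + 1))) := by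
          gcongr
          linarith
      _ = 1 := by field_simp; norm_num
  have hcover : jSet a |r - t| ⊆ (jSet a |r - s| ∪ jSet a |s - t|) ∪
      ({n | n + 1 ∈ jSet a |r - s|} ∪ {n | n + 1 ∈ jSet a |s - t|}) ∪
      ((D ∪ {n | n + 1 ∈ D}) \ {k | k < N}) := by
    intro k hk
    have hkN : N ≤ k := le_of_mem_jSet ha (abs_nonneg _) hstart hk
    rw [hxy] at hk
    have h := jSet_abs_add_subset ha _ _ hk
    simp only [mem_union, Set.mem_sdiff, mem_ofPred_eq, not_lt] at h ⊢
    tauto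
  have hφbound : φ (jSet a |r - t|) ≤ ENNReal.ofReal (5 * η) := by
    calc φ (jSet a |r - t|)
        ≤ (φ (jSet a |r - s|) + φ (jSet a |s - t|)) +
          (φ {n | n + 1 ∈ jSet a |r - s|} + φ {n | n + 1 ∈ jSet a |s - t|}) +
          φ ((D ∪ {n | n + 1 ∈ D}) \ {k | k < N}) :=
          (hφ.le_add_of_subset hcover).trans (by
            gcongr
            exact (hφ.2.2.1 _ _).trans (add_le_add (hφ.2.2.1 _ _) (hφ.2.2.1 _ _)))
      _ ≤ (ENNReal.ofReal η + ENNReal.ofReal η) + (ENNReal.ofReal η + ENNReal.ofReal η) +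
          ENNReal.ofReal η :=
          add_le_add (add_le_add
            (add_le_add (small r s _ hx hrsη).1.le (small s t _ hy hstη).1.le)
            (add_le_add (hshift _ hx ((small r s _ hx hrs₂).1.trans_le hδ₂₁)).le
              (hshift _ hy ((small s t _ hy hst₂).1.trans_le hδ₂₁)).le)) hN.le
      _ = ENNReal.ofReal (5 * η) := by
          rw [← ENNReal.ofReal_add hη.le hη.le, ← ENNReal.ofReal_add (by positivity) (by positivity),
            ← ENNReal.ofReal_add (by positivity) hη.le]
          ring_nf
  have h1 := ENNReal.toReal_le_of_le_ofReal (by positivity) hφbound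
  have h2 := (small r s _ hx hrsη).2
  have h3 := (small s t _ hy hstη).2
  change (φ (jSet a |r - t|)).toReal + |r - t| < ε
  linarith
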